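/- arXiv:1204.5029 — 2 statements merged into one kernel-verified Lean document; each statement's English description precedes it below -/
import Mathlib

section
/- Let 1 ≤ p < ∞, let σ ∈ L^p(ℝ^{2d}) with distributional Fourier transform σ̂ supported in Q = [−1/(2a), 1/(2a)]^d × [−1/(2b), 1/(2b)]^d, and let g ∈ L¹(ℝ^d) with ĝ ∈ L¹(ℝ^d). Choose φ ∈ C_c^∞(ℝ^{2d}) with φ = 1 on Q, assume conj(UV_g g), where (UV_g g)(ξ,x) = V_g g(−x,ξ), does not vanish on supp φ, and let K ∈ L¹(ℝ^{2d}) be the inverse Fourier transform of φ / conj(UV_g g) (which lies in the Fourier algebra ℱL¹ by the Wiener–Lévy theorem). Then the deconvolution identity σ ∗ R(g,g)^∗ ∗ K = σ holds in L^p(ℝ^{2d}), where R(g,g)^∗(x) = conj(R(g,g)(−x)). -/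
noncomputable section

open MeasureTheory Complex Filter Real
open scoped FourierTransform Convolution Topology ENNReal

/-- first `d` coordinates of a point of ℝ^{d+d} -/
def zx {d : ℕ} (z : EuclideanSpace ℝ (Fin (d + d))) : EuclideanSpace ℝ (Fin d) :=
  (EuclideanSpace.equiv (Fin d) ℝ).symm fun i => z (Fin.castAdd d i)

/-- last `d` coordinates of a point of ℝ^{d+d} -/
def zxi {d : ℕ} (z : EuclideanSpace ℝ (Fin (d + d))) : EuclideanSpace ℝ (Fin d) :=
  (EuclideanSpace.equiv (Fin d) ℝ).symm fun i => z (Fin.natAdd d i)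

/-- build a point of ℝ^{d+d} from two points of ℝ^d -/
def mk2 {d : ℕ} (x ξ : EuclideanSpace ℝ (Fin d)) : EuclideanSpace ℝ (Fin (d + d)) :=
  (EuclideanSpace.equiv (Fin (d + d)) ℝ).symm fun i =>
    Sum.elim (fun j => x j) (fun j => ξ j) (finSumFinEquiv.symm i)

/-- the vector (a k₁, …, a k_d) ∈ ℝ^d for k ∈ ℤ^d -/
def vecd {d : ℕ} (a : ℝ) (k : Fin d → ℤ) : EuclideanSpace ℝ (Fin d) :=
  (EuclideanSpace.equiv (Fin d) ℝ).symm fun i => a * (k i : ℝ)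

/-- time-frequency shift π(x,ξ) f (t) = e^{2πi ξ·t} f(t-x) -/
def tf {d : ℕ} (x ξ : EuclideanSpace ℝ (Fin d)) (f : EuclideanSpace ℝ (Fin d) → ℂ) :
    EuclideanSpace ℝ (Fin d) → ℂ :=
  fun t => Complex.exp (2 * Real.pi * Complex.I * (inner ℝ ξ t : ℝ)) * f (t - x)

/-- short-time Fourier transform V_g f(x, ξ) = ∫ f(t) conj(g(t-x)) e^{-2πi ξ·t} dt -/
def stft {d : ℕ} (g f : EuclideanSpace ℝ (Fin d) → ℂ) (x ξ : EuclideanSpace ℝ (Fin d)) : ℂ :=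
  ∫ t, f t * (starRingEnd ℂ) (g (t - x)) *
    Complex.exp (-(2 * Real.pi * Complex.I) * (inner ℝ ξ t : ℝ))

/-- Rihaczek distribution R(f,g)(x,ξ) = f(x) conj(ĝ(ξ)) e^{-2πi x·ξ},
as a function on ℝ^{d+d} with variable z = (x, ξ) -/
def rihaczek {d : ℕ} (f g : EuclideanSpace ℝ (Fin d) → ℂ)
    (z : EuclideanSpace ℝ (Fin (d + d))) : ℂ :=
  f (zx z) * (starRingEnd ℂ) (𝓕 g (zxi z)) *
    Complex.exp (-(2 * Real.pi * Complex.I) * (inner ℝ (zx z) (zxi z) : ℝ))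

/-- (𝒰 V_g g)(ξ, x) = V_g g(-x, ξ), as a function on ℝ^{d+d} with variable z = (ξ, x) -/
def UVgg {d : ℕ} (g : EuclideanSpace ℝ (Fin d) → ℂ)
    (z : EuclideanSpace ℝ (Fin (d + d))) : ℂ :=
  stft g g (-(zxi z)) (zx z)

/-- the point (a k, b l) of the lattice Λ = aℤ^d × bℤ^d, as a point of ℝ^{d+d} -/
def lat {d : ℕ} (a b : ℝ) (kl : (Fin d → ℤ) × (Fin d → ℤ)) :
    EuclideanSpace ℝ (Fin (d + d)) :=
  mk2 (vecd a kl.1) (vecd b kl.2)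

/-- one-dimensional normalized sinc: t ↦ sin(πct)/(πct), equal to 1 at t = 0 -/
def sinc1 (c t : ℝ) : ℝ :=
  if t = 0 then 1 else Real.sin (Real.pi * c * t) / (Real.pi * c * t)

/-- the sinc function on ℝ^{d+d} adapted to the lattice aℤ^d × bℤ^d -/
def sincL {d : ℕ} (a b : ℝ) (z : EuclideanSpace ℝ (Fin (d + d))) : ℂ :=
  ((∏ i, sinc1 a (zx z i)) * ∏ i, sinc1 b (zxi z i) : ℝ)

/-- the closed box [-1/(2a)+ε, 1/(2a)-ε]^d × [-1/(2b)+ε, 1/(2b)-ε]^d ⊆ ℝ^{d+d};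
for ε = 0 this is the box Q = [-1/(2a), 1/(2a)]^d × [-1/(2b), 1/(2b)]^d -/
def Qbox {d : ℕ} (a b ε : ℝ) : Set (EuclideanSpace ℝ (Fin (d + d))) :=
  {z | (∀ i, |zx z i| ≤ 1 / (2 * a) - ε) ∧ (∀ i, |zxi z i| ≤ 1 / (2 * b) - ε)}

/-- diagonal entry H_{λλ} = ⟨σ^{KN} π(λ)g, π(λ)g⟩ = ∫ σ(z) conj(R(π(λ)g,π(λ)g)(z)) dz
of the channel matrix of a (locally integrable) symbol σ, at λ = (a k, b l) -/
def Hdiag {d : ℕ} (σ : EuclideanSpace ℝ (Fin (d + d)) → ℂ)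
    (g : EuclideanSpace ℝ (Fin d) → ℂ) (a b : ℝ) (kl : (Fin d → ℤ) × (Fin d → ℤ)) : ℂ :=
  ∫ z, σ z * (starRingEnd ℂ)
    (rihaczek (tf (vecd a kl.1) (vecd b kl.2) g) (tf (vecd a kl.1) (vecd b kl.2) g) z)

open scoped ContDiff SchwartzMap

section FourierAlgebra

variable {V : Type*} [NormedAddCommGroup V] [InnerProductSpace ℝ V] [FiniteDimensional ℝ V]
  [MeasurableSpace V] [BorelSpace V]

theorem continuous_fourier_of_integrable {f : V → ℂ} (hf : Integrable f) : Continuous (𝓕 f) :=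
  VectorFourier.fourierIntegral_continuous Real.continuous_fourierChar
    (innerSL ℝ).continuous₂ hf

theorem norm_fourier_le_integral_norm (f : V → ℂ) (z : V) : ‖𝓕 f z‖ ≤ ∫ x, ‖f x‖ :=
  VectorFourier.norm_fourierIntegral_le_integral_norm _ _ _ _ _

theorem fourier_const_smul_apply (c : ℂ) (f : V → ℂ) (z : V) : 𝓕 (c • f) z = c * 𝓕 f z :=
  congrFun (VectorFourier.fourierIntegral_const_smul 𝐞 volume (innerₗ V) f c) z

theorem fourier_add_apply {f g : V → ℂ} (hf : Integrable f) (hg : Integrable g) (z : V) :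
    𝓕 (f + g) z = 𝓕 f z + 𝓕 g z :=
  congrFun (VectorFourier.fourierIntegral_add Real.continuous_fourierChar
    (innerSL ℝ).continuous₂ hf hg) z

/-- The Fourier transform is self-adjoint for the bilinear pairing. -/
theorem integral_fourier_mul_eq_mul_fourier {f g : V → ℂ} (hf : Integrable f)
    (hg : Integrable g) : ∫ x, 𝓕 f x * g x = ∫ x, f x * 𝓕 g x := by
  have := VectorFourier.integral_fourierIntegral_smul_eq_flip (L := innerₗ V) (μ := volume)
    (ν := volume) Real.continuous_fourierChar (innerSL ℝ).continuous₂ hf hg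
  rw [flip_innerₗ] at this
  exact this

/-- The inverse Fourier transform is self-adjoint for the bilinear pairing. -/
theorem integral_fourierInv_mul_eq_mul_fourierInv {f g : V → ℂ} (hf : Integrable f)
    (hg : Integrable g) : ∫ x, 𝓕⁻ f x * g x = ∫ x, f x * 𝓕⁻ g x := by
  have h := integral_fourier_mul_eq_mul_fourier hf hg.comp_neg
  rw [fourierInv_eq_fourier_comp_neg g]
  rw [← h, ← integral_neg_eq_self (fun x => 𝓕 f x * g (-x))]
  simp [fourierInv_eq_fourier_neg]

/-- Almost everywhere form of the Fourier inversion formula. -/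
theorem fourierInv_fourier_ae_eq {f : V → ℂ} (hf : Integrable f) (h'f : Integrable (𝓕 f)) :
    𝓕⁻ (𝓕 f) =ᵐ[volume] f := by
  have hc : Continuous (𝓕⁻ (𝓕 f)) := by
    rw [fourierInv_eq_fourier_comp_neg]
    exact continuous_fourier_of_integrable h'f.comp_neg
  refine ae_eq_of_integral_contDiff_smul_eq hc.locallyIntegrable hf.locallyIntegrable ?_
  intro θ hθ hθc
  have h₁ : HasCompactSupport (Complex.ofRealCLM ∘ θ) := hθc.comp_left rfl
  have h₂ : ContDiff ℝ ∞ (Complex.ofRealCLM ∘ θ) := by fun_prop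
  set Θ : 𝓢(V, ℂ) := h₁.toSchwartzMap h₂ with hΘ
  have e (x : V) : (θ x : ℂ) = Θ x := rfl
  have e1 := integral_fourierInv_mul_eq_mul_fourierInv h'f Θ.integrable
  have e2 := integral_fourier_mul_eq_mul_fourier hf (𝓕⁻ Θ).integrable
  rw [← SchwartzMap.fourier_coe, FourierTransform.fourier_fourierInv_eq,
    SchwartzMap.fourierInv_coe] at e2
  simp only [Complex.real_smul, e]
  simp only [mul_comm (Θ _)]
  rw [e1, e2]

/-- Convolution with an integrable function of small norm is invertible after adding a nonzero
multiple of the identity. -/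
theorem exists_fourier_eq_div_add {c : ℂ} {m Φ : V → ℂ} (hm : Integrable m)
    (hmc : ∫ x, ‖m x‖ < ‖c‖) (hΦ : Integrable Φ) :
    ∃ k : V → ℂ, Integrable k ∧ ∀ z, 𝓕 k z = 𝓕 Φ z / (c + 𝓕 m z) := by
  have hc : 0 < ‖c‖ := (integral_nonneg fun _ => norm_nonneg _).trans_lt hmc
  have hc0 : c ≠ 0 := norm_pos_iff.1 hc
  let B := ContinuousLinearMap.mul ℂ ℂ
  let F : ℕ → V → ℂ := fun n => Nat.rec (c⁻¹ • Φ) (fun _ f => (-c⁻¹) • (f ⋆[B] m)) n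
  have hF (n : ℕ) : Integrable (F n) := by
    induction n with
    | zero => exact hΦ.smul _
    | succ n ih => exact (ih.integrable_convolution B hm).smul _
  set q : ℝ := ‖c‖⁻¹ * ∫ x, ‖m x‖ with hq
  have hq0 : 0 ≤ q := mul_nonneg (by positivity) (integral_nonneg fun _ => norm_nonneg _)
  have hq1 : q < 1 := by rw [hq, inv_mul_lt_iff₀ hc]; simpa using hmc
  have hstep (n : ℕ) : ∫ x, ‖F (n + 1) x‖ ≤ q * ∫ x, ‖F n x‖ := by
    have h1 : ∫ x, ‖(F n ⋆[B] m) x‖ ≤ (∫ x, ‖F n x‖) * ∫ x, ‖m x‖ := by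
      have h2 := integral_convolution (ContinuousLinearMap.mul ℝ ℝ) (hF n).norm hm.norm
        (μ := volume) (ν := volume)
      rw [ContinuousLinearMap.mul_apply'] at h2
      rw [← h2]
      refine integral_mono ((hF n).integrable_convolution B hm).norm
        ((hF n).norm.integrable_convolution _ hm.norm) fun x => ?_
      refine (norm_integral_le_integral_norm _).trans_eq ?_
      simp [convolution_def, B]
    calc ∫ x, ‖F (n + 1) x‖ = ‖c‖⁻¹ * ∫ x, ‖(F n ⋆[B] m) x‖ := by
          rw [← integral_const_mul]
          refine integral_congr_ae (.of_forall fun x => ?_)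
          simp [F]
      _ ≤ ‖c‖⁻¹ * ((∫ x, ‖F n x‖) * ∫ x, ‖m x‖) := by gcongr
      _ = _ := by rw [hq]; ring
  have hgeom (n : ℕ) : ∫ x, ‖F n x‖ ≤ (∫ x, ‖F 0 x‖) * q ^ n := by
    induction n with
    | zero => simp
    | succ n ih =>
      calc _ ≤ q * ∫ x, ‖F n x‖ := hstep n
        _ ≤ q * ((∫ x, ‖F 0 x‖) * q ^ n) := by gcongr
        _ = _ := by ring
  have hft (n : ℕ) (z : V) : 𝓕 (F n) z = 𝓕 Φ z / c * (-(𝓕 m z) / c) ^ n := by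
    induction n with
    | zero =>
      change 𝓕 (c⁻¹ • Φ) z = _
      rw [fourier_const_smul_apply]
      simp [div_eq_inv_mul]
    | succ n ih =>
      change 𝓕 ((-c⁻¹) • (F n ⋆[B] m)) z = _
      rw [fourier_const_smul_apply, Real.fourier_mul_convolution_eq (hF n) hm, ih]
      ring
  let G : ℕ → Lp ℂ 1 (volume : Measure V) := fun n => (hF n).toL1
  have hGs : Summable G := by
    refine Summable.of_norm_bounded
      ((summable_geometric_of_lt_one hq0 hq1).mul_left (∫ x, ‖F 0 x‖)) fun n => ?_
    exact (L1.norm_of_fun_eq_integral_norm (hF n)).trans_le (hgeom n)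
  refine ⟨(∑' n, G n : Lp ℂ 1 (volume : Measure V)), L1.integrable_coeFn _, fun z => ?_⟩
  have h1 := ((hGs.hasSum.mapL (Real.Lp.fourierTransformCLM V ℂ)).mapL
    (BoundedContinuousFunction.evalCLM ℂ z))
  have h2 (n : ℕ) : (BoundedContinuousFunction.evalCLM ℂ z)
      ((Real.Lp.fourierTransformCLM V ℂ) (G n)) = 𝓕 Φ z / c * (-(𝓕 m z) / c) ^ n := by
    rw [← hft]
    exact Real.fourier_congr_ae (hF n).coeFn_toL1 z
  simp_rw [h2] at h1
  have h3 : ‖-(𝓕 m z) / c‖ < 1 := by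
    rw [norm_div, norm_neg, div_lt_one hc]
    exact (norm_fourier_le_integral_norm m z).trans_lt hmc
  have h4 := (hasSum_geometric_of_norm_lt_one h3).mul_left (𝓕 Φ z / c)
  have h5 := h1.unique h4
  have h6 : c + 𝓕 m z ≠ 0 := by
    intro h
    have : ‖𝓕 m z‖ = ‖c‖ := by rw [eq_neg_of_add_eq_zero_left h, norm_neg]
    exact absurd (norm_fourier_le_integral_norm m z) (by rw [this]; exact not_le.2 hmc)
  refine Eq.trans h5 ?_
  have h7 : 1 - -(𝓕 m z) / c = (c + 𝓕 m z) / c := by field_simp; ring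
  rw [h7]
  field_simp

theorem SchwartzMap.exists_norm_le_one_add_norm_rpow {E : Type*} [NormedAddCommGroup E]
    [NormedSpace ℝ E] (f : 𝓢(E, ℂ)) (k : ℕ) :
    ∃ C : ℝ, 0 ≤ C ∧ ∀ x, ‖f x‖ ≤ C * (1 + ‖x‖) ^ (-(k : ℝ)) := by
  refine ⟨2 ^ k * ((Finset.Iic (k, 0)).sup fun m => SchwartzMap.seminorm ℝ m.1 m.2) f,
    by positivity, fun x => ?_⟩
  have h := SchwartzMap.one_add_le_sup_seminorm_apply (𝕜 := ℝ) (m := (k, 0)) le_rfl le_rfl f x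
  rw [norm_iteratedFDeriv_zero] at h
  have hx : 0 < 1 + ‖x‖ := by positivity
  rw [rpow_neg hx.le, rpow_natCast, ← div_eq_mul_inv, le_div_iff₀ (by positivity), mul_comm]
  exact h

theorem integrable_one_add_norm_rpow_finrank :
    Integrable fun x : V => (1 + ‖x‖) ^ (-((Module.finrank ℝ V + 1 : ℕ) : ℝ)) :=
  integrable_one_add_norm (by push_cast; linarith)

theorem SchwartzMap.tendsto_integral_norm_sub_translate (T : 𝓢(V, ℂ)) :
    Tendsto (fun v => ∫ x, ‖T (x - v) - T x‖) (𝓝 0) (𝓝 0) := by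
  obtain ⟨C, hC0, hC⟩ := T.exists_norm_le_one_add_norm_rpow (Module.finrank ℝ V + 1)
  set N : ℕ := Module.finrank ℝ V + 1 with hN
  have hlim : Tendsto (fun v => ∫ x, ‖T (x - v) - T x‖) (𝓝 0) (𝓝 (∫ _x : V, (0 : ℝ))) := by
    refine tendsto_integral_filter_of_dominated_convergence
      (fun x => (C * 2 ^ N + C) * (1 + ‖x‖) ^ (-(N : ℝ))) ?_ ?_ ?_ ?_
    · refine .of_forall fun v => Continuous.aestronglyMeasurable ?_
      have := T.continuous
      fun_prop
    · filter_upwards [Metric.ball_mem_nhds (0 : V) one_pos] with v hv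
      refine .of_forall fun x => ?_
      rw [mem_ball_zero_iff] at hv
      have h1 : (1 + ‖x - v‖) ^ (-(N : ℝ)) ≤ 2 ^ N * (1 + ‖x‖) ^ (-(N : ℝ)) := by
        have hx : 0 < 1 + ‖x‖ := by positivity
        have hxv : 0 < 1 + ‖x - v‖ := by positivity
        rw [rpow_neg hx.le, rpow_neg hxv.le, rpow_natCast, rpow_natCast, ← div_eq_mul_inv,
          le_div_iff₀ (by positivity), inv_mul_le_iff₀ (by positivity), ← mul_pow]
        gcongr
        have := norm_sub_norm_le x v
        nlinarith [norm_nonneg (x - v)]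
      rw [norm_norm]
      calc ‖T (x - v) - T x‖ ≤ ‖T (x - v)‖ + ‖T x‖ := norm_sub_le _ _
        _ ≤ C * (1 + ‖x - v‖) ^ (-(N : ℝ)) + C * (1 + ‖x‖) ^ (-(N : ℝ)) :=
          add_le_add (hC _) (hC _)
        _ ≤ C * (2 ^ N * (1 + ‖x‖) ^ (-(N : ℝ))) + C * (1 + ‖x‖) ^ (-(N : ℝ)) := by gcongr
        _ = _ := by ring
    · exact integrable_one_add_norm_rpow_finrank.const_mul _
    · refine .of_forall fun x => ?_
      have hc : Continuous fun v => ‖T (x - v) - T x‖ := by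
        have := T.continuous
        fun_prop
      simpa using hc.tendsto 0
  simpa using hlim

/-- Fourier transform of an `L¹`-normalized dilation. -/
theorem fourier_dilation (f : V → ℂ) {δ : ℝ} (hδ : 0 < δ) (z : V) :
    𝓕 (fun x => (δ : ℂ) ^ Module.finrank ℝ V * f (δ • x)) z = 𝓕 f (δ⁻¹ • z) := by
  have h := Measure.integral_comp_smul_of_nonneg volume
    (fun x => 𝐞 (-inner ℝ x (δ⁻¹ • z)) • f x) δ (hR := hδ.le)
  have hn : (δ : ℂ) ^ Module.finrank ℝ V ≠ 0 := pow_ne_zero _ (by exact_mod_cast hδ.ne')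
  rw [Real.fourier_eq, Real.fourier_eq]
  have e : ∀ x : V, 𝐞 (-inner ℝ x z) • ((δ : ℂ) ^ Module.finrank ℝ V * f (δ • x)) =
      (δ : ℂ) ^ Module.finrank ℝ V * (𝐞 (-inner ℝ (δ • x) (δ⁻¹ • z)) • f (δ • x)) := by
    intro x
    have : inner ℝ (δ • x) (δ⁻¹ • z) = (inner ℝ x z : ℝ) := by
      rw [real_inner_smul_left, real_inner_smul_right, mul_inv_cancel_left₀ hδ.ne']
    rw [this, mul_smul_comm]
  simp_rw [e]
  rw [integral_const_mul, h, Complex.real_smul]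
  push_cast
  rw [mul_inv_cancel_left₀ hn]

/-- Near the origin, the Fourier transform of an integrable function differs from its value at the
origin by the Fourier transform of a function of small norm. -/
theorem exists_small_fourier_eq_sub_zero {H : V → ℂ} (hH : Integrable H) {ε : ℝ} (hε : 0 < ε) :
    ∃ r > 0, ∃ m : V → ℂ, Integrable m ∧ ∫ x, ‖m x‖ < ε ∧
      ∀ z ∈ Metric.ball (0 : V) r, 𝓕 m z = 𝓕 H z - 𝓕 H 0 := by
  let τ : ContDiffBump (0 : V) := ⟨1, 2, one_pos, one_lt_two⟩
  have h₁ : HasCompactSupport (Complex.ofRealCLM ∘ τ) := τ.hasCompactSupport.comp_left rfl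
  have h₂ : ContDiff ℝ ∞ (Complex.ofRealCLM ∘ τ) := Complex.ofRealCLM.contDiff.comp τ.contDiff
  let τS : 𝓢(V, ℂ) := h₁.toSchwartzMap h₂
  let T : 𝓢(V, ℂ) := 𝓕⁻ τS
  have hT (z : V) (hz : ‖z‖ < 1) : 𝓕 (T : V → ℂ) z = 1 := by
    rw [← SchwartzMap.fourier_coe, FourierTransform.fourier_fourierInv_eq]
    change ((τ z : ℝ) : ℂ) = 1
    rw [τ.one_of_mem_closedBall (by simpa [τ] using hz.le)]
    simp
  let n := Module.finrank ℝ V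
  let B := ContinuousLinearMap.mul ℂ ℂ
  let D : ℝ → V → ℂ := fun δ x => (δ : ℂ) ^ n * T (δ • x)
  let m : ℝ → V → ℂ := fun δ => (H ⋆[B] D δ) + (-𝓕 H 0) • D δ
  have hD (δ : ℝ) (hδ : 0 < δ) : Integrable (D δ) :=
    (T.integrable.comp_smul hδ.ne').const_mul _
  have hm (δ : ℝ) (hδ : 0 < δ) : Integrable (m δ) :=
    (hH.integrable_convolution B (hD δ hδ)).add ((hD δ hδ).smul _)
  let G : V → ℝ := fun v => ∫ x, ‖T (x - v) - T x‖
  have hGlim : Tendsto G (𝓝 0) (𝓝 0) := T.tendsto_integral_norm_sub_translate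
  have hDG (δ : ℝ) (hδ : 0 < δ) (y : V) : ∫ x, ‖D δ (x - y) - D δ x‖ = G (δ • y) := by
    have h := Measure.integral_comp_smul_of_nonneg volume
      (fun x => ‖T (x - δ • y) - T x‖) δ (hR := hδ.le)
    have hn : δ ^ n ≠ 0 := pow_ne_zero _ hδ.ne'
    have e (x : V) : ‖D δ (x - y) - D δ x‖ = δ ^ n * ‖T (δ • x - δ • y) - T (δ • x)‖ := by
      simp only [D]
      rw [← mul_sub, norm_mul, norm_pow, Complex.norm_real, Real.norm_of_nonneg hδ.le, smul_sub]
    simp_rw [e]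
    rw [integral_const_mul, h, smul_eq_mul, mul_inv_cancel_left₀ hn]
  have hGm : StronglyMeasurable G := by
    have hc : Continuous (Function.uncurry fun v x : V => ‖T (x - v) - T x‖) := by
      have := T.continuous
      fun_prop
    exact hc.stronglyMeasurable.integral_prod_right
  have hGb (v : V) : ‖G v‖ ≤ 2 * ∫ x, ‖T x‖ := by
    rw [Real.norm_of_nonneg (integral_nonneg fun _ => norm_nonneg _)]
    calc G v ≤ ∫ x, (‖T (x - v)‖ + ‖T x‖) :=
          integral_mono ((T.integrable.comp_sub_right v).sub T.integrable).norm
            ((T.integrable.comp_sub_right v).norm.add T.integrable.norm) fun x => norm_sub_le _ _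
      _ = _ := by
        rw [integral_add (T.integrable.comp_sub_right v).norm T.integrable.norm,
          integral_sub_right_eq_self (fun x => ‖T x‖) v]
        ring
  have hnorm (δ : ℝ) (hδ : 0 < δ) : ∫ x, ‖m δ x‖ ≤ ∫ y, ‖H y‖ * G (δ • y) := by
    have hI : Integrable (fun p : V × V => H p.2 * (D δ (p.1 - p.2) - D δ p.1)) := by
      have e1 := hH.convolution_integrand B (hD δ hδ) (μ := volume) (ν := volume)
      have e2 := (hD δ hδ).mul_prod hH (μ := volume) (ν := volume)
      refine (e1.sub e2).congr (.of_forall fun p => ?_)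
      simp [B]; ring
    have e (x : V) (hx : ConvolutionExistsAt H (D δ) x B) :
        m δ x = ∫ y, H y * (D δ (x - y) - D δ x) := by
      have h0 : 𝓕 H 0 = ∫ y, H y := by simp [Real.fourier_eq]
      simp only [m, Pi.add_apply, Pi.smul_apply, smul_eq_mul, h0, mul_sub]
      have hx' : Integrable fun y => H y * D δ (x - y) := hx
      rw [integral_sub hx' (hH.mul_const _), integral_mul_const, neg_mul, ← sub_eq_add_neg]
      rfl
    calc ∫ x, ‖m δ x‖ ≤ ∫ x, ∫ y, ‖H y * (D δ (x - y) - D δ x)‖ := by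
          refine integral_mono_ae (hm δ hδ).norm hI.norm.integral_prod_left ?_
          filter_upwards [hH.ae_convolution_exists B (hD δ hδ)] with x hx
          rw [e x hx]
          exact norm_integral_le_integral_norm _
      _ = ∫ y, ∫ x, ‖H y * (D δ (x - y) - D δ x)‖ := integral_integral_swap hI.norm
      _ = ∫ y, ‖H y‖ * G (δ • y) := by
          simp_rw [norm_mul, integral_const_mul, hDG δ hδ]
  have hlim : Tendsto (fun δ : ℝ => ∫ y, ‖H y‖ * G (δ • y)) (𝓝[>] 0) (𝓝 0) := by
    have : Tendsto (fun δ : ℝ => ∫ y, ‖H y‖ * G (δ • y)) (𝓝[>] 0) (𝓝 (∫ _y : V, (0 : ℝ))) := by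
      refine tendsto_integral_filter_of_dominated_convergence
        (fun y => ‖H y‖ * (2 * ∫ x, ‖T x‖)) ?_ ?_ (hH.norm.mul_const _) ?_
      · refine .of_forall fun δ => hH.norm.aestronglyMeasurable.mul ?_
        exact (hGm.comp_measurable (measurable_const_smul δ)).aestronglyMeasurable
      · refine .of_forall fun δ => .of_forall fun y => ?_
        rw [norm_mul, norm_norm]
        gcongr
        exact hGb _
      · refine .of_forall fun y => ?_
        have h1 : Tendsto (fun δ : ℝ => δ • y) (𝓝[>] 0) (𝓝 0) := by
          have : Continuous fun δ : ℝ => δ • y := by fun_prop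
          simpa using (this.tendsto 0).mono_left nhdsWithin_le_nhds
        simpa using (hGlim.comp h1).const_mul ‖H y‖
    simpa using this
  obtain ⟨δ, hδε, hδ⟩ := ((hlim.eventually_lt_const hε).and self_mem_nhdsWithin).exists
  have hδ0 : 0 < δ := hδ
  refine ⟨δ, hδ0, m δ, hm δ hδ0, (hnorm δ hδ0).trans_lt hδε, fun z hz => ?_⟩
  have hDz : 𝓕 (D δ) z = 1 := by
    rw [show 𝓕 (D δ) z = _ from fourier_dilation T hδ0 z]
    refine hT _ ?_
    rw [mem_ball_zero_iff] at hz
    rw [norm_smul, norm_inv, Real.norm_of_nonneg hδ0.le, inv_mul_lt_iff₀ hδ0]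
    simpa using hz
  simp only [m]
  rw [fourier_add_apply (hH.integrable_convolution B (hD δ hδ0)) ((hD δ hδ0).smul _),
    fourier_const_smul_apply, Real.fourier_mul_convolution_eq hH (hD δ hδ0), hDz]
  ring

/-- Near a point, the Fourier transform of an integrable function differs from its value at that
point by the Fourier transform of a function of small norm. -/
theorem exists_small_fourier_eq_sub {h : V → ℂ} (hh : Integrable h) (z₀ : V) {ε : ℝ}
    (hε : 0 < ε) :
    ∃ r > 0, ∃ m : V → ℂ, Integrable m ∧ ∫ x, ‖m x‖ < ε ∧
      ∀ z ∈ Metric.ball z₀ r, 𝓕 m z = 𝓕 h z - 𝓕 h z₀ := by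
  let H : V → ℂ := fun x => 𝐞 (-inner ℝ x z₀) • h x
  have hH : Integrable H := (Real.fourierIntegral_convergent_iff z₀).2 hh
  have hHz (z : V) : 𝓕 H z = 𝓕 h (z + z₀) := by
    simp only [Real.fourier_eq, H, smul_smul, ← AddChar.map_add_eq_mul, inner_add_right, neg_add]
  obtain ⟨r, hr, m, hm, hmε, hmz⟩ := exists_small_fourier_eq_sub_zero hH hε
  refine ⟨r, hr, fun x => 𝐞 (-inner ℝ x (-z₀)) • m x,
    (Real.fourierIntegral_convergent_iff (-z₀)).2 hm, by simpa [Circle.norm_smul] using hmε,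
    fun z hz => ?_⟩
  have h1 := hmz (z - z₀) (by rw [mem_ball_zero_iff, ← dist_eq_norm]; exact hz)
  rw [hHz, hHz, sub_add_cancel, zero_add] at h1
  rw [← h1]
  simp only [Real.fourier_eq, smul_smul, ← AddChar.map_add_eq_mul, sub_eq_add_neg,
    inner_add_right, neg_add]

theorem exists_fourier_eq_div_of_tsupport_subset_ball {h : V → ℂ} (hh : Integrable h) {z₀ : V}
    (hz₀ : 𝓕 h z₀ ≠ 0) :
    ∃ r > 0, ∀ φ : V → ℂ, ContDiff ℝ ∞ φ → HasCompactSupport φ →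
      tsupport φ ⊆ Metric.ball z₀ r →
      ∃ k : V → ℂ, Integrable k ∧ ∀ z, 𝓕 k z = φ z / 𝓕 h z := by
  obtain ⟨r, hr, m, hm, hmc, hmz⟩ := exists_small_fourier_eq_sub hh z₀ (norm_pos_iff.2 hz₀)
  refine ⟨r, hr, fun φ hφ hφc hφr => ?_⟩
  let Φ : 𝓢(V, ℂ) := 𝓕⁻ (hφc.toSchwartzMap hφ)
  have hΦ : 𝓕 (Φ : V → ℂ) = φ := by
    rw [← SchwartzMap.fourier_coe, FourierTransform.fourier_fourierInv_eq]
    rfl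
  obtain ⟨k, hk, hkz⟩ := exists_fourier_eq_div_add hm hmc Φ.integrable
  refine ⟨k, hk, fun z => ?_⟩
  rw [hkz, hΦ]
  by_cases hz : z ∈ tsupport φ
  · rw [hmz z (hφr hz), add_sub_cancel]
  · simp [image_eq_zero_of_notMem_tsupport hz]

/-- Local form of the Wiener–Lévy theorem: a smooth compactly supported function divided by the
Fourier transform of an integrable function without zeros on its support is again the Fourier
transform of an integrable function. -/
theorem exists_fourier_eq_div {h : V → ℂ} (hh : Integrable h) {φ : V → ℂ}
    (hφ : ContDiff ℝ ∞ φ) (hφc : HasCompactSupport φ) (hne : ∀ z ∈ tsupport φ, 𝓕 h z ≠ 0) :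
    ∃ k : V → ℂ, Integrable k ∧ ∀ z, 𝓕 k z = φ z / 𝓕 h z := by
  choose! r hr hk using fun (z : V) (hz : z ∈ tsupport φ) =>
    exists_fourier_eq_div_of_tsupport_subset_ball hh (hne z hz)
  obtain ⟨t, ht, hcov⟩ := hφc.isCompact.elim_nhds_subcover (fun z => Metric.ball z (r z))
    fun z hz => Metric.ball_mem_nhds z (hr z hz)
  obtain ⟨f, hf⟩ := SmoothPartitionOfUnity.exists_isSubordinate (modelWithCornersSelf ℝ V)
    (isClosed_tsupport φ) (fun z : t => Metric.ball (z : V) (r z)) (fun _ => Metric.isOpen_ball)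
    (fun z hz => by
      obtain ⟨i, hi, hzi⟩ := Set.mem_iUnion₂.1 (hcov hz)
      exact Set.mem_iUnion.2 ⟨⟨i, hi⟩, hzi⟩)
  have hex (i : t) : ∃ k : V → ℂ, Integrable k ∧ ∀ z, 𝓕 k z = (f i z : ℂ) * φ z / 𝓕 h z := by
    refine hk i (ht i i.2) (fun z => (f i z : ℂ) * φ z) ?_ hφc.mul_left ?_
    · have : ContDiff ℝ ∞ (f i) := (f i).contMDiff.contDiff
      exact (Complex.ofRealCLM.contDiff.comp this).mul hφ
    · refine (tsupport_mul_subset_left).trans (subset_trans ?_ (hf i))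
      exact closure_mono fun z hz => by simpa using hz
  choose k hkint hkz using hex
  refine ⟨∑ i, k i, integrable_finsetSum' _ fun i _ => hkint i, fun z => ?_⟩
  have hsum (s : Finset t) : 𝓕 (∑ i ∈ s, k i) z = ∑ i ∈ s, 𝓕 (k i) z := by
    classical
    induction s using Finset.induction_on with
    | empty => simp [Real.fourier_eq]
    | insert i s hi ih =>
      rw [Finset.sum_insert hi, Finset.sum_insert hi,
        fourier_add_apply (hkint i) (integrable_finsetSum' _ fun i _ => hkint i), ih]
  rw [hsum]
  simp_rw [hkz, ← Finset.sum_div, ← Finset.sum_mul]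
  by_cases hz : z ∈ tsupport φ
  · have h1 := f.sum_eq_one hz
    rw [finsum_eq_sum_of_fintype] at h1
    rw [← Complex.ofReal_sum, h1]
    simp
  · simp [image_eq_zero_of_notMem_tsupport hz]

section Spectrum

variable {σ : V → ℂ} {τ : V → ℝ}

theorem integrable_mul_of_norm_le_one_add (hσ : AEStronglyMeasurable σ) (hτ : Integrable τ)
    (hστ : ∀ z, ‖σ z‖ ≤ 1 + τ z) {f : V → ℂ} (hf : Integrable f) {C : ℝ}
    (hC : ∀ z, ‖f z‖ ≤ C) : Integrable fun z => σ z * f z := by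
  have hτf : Integrable fun z => τ z * ‖f z‖ :=
    hτ.mul_bdd hf.aestronglyMeasurable.norm (c := C) (.of_forall fun z => by simpa using hC z)
  refine (hf.norm.add hτf).mono' (hσ.mul hf.aestronglyMeasurable) (.of_forall fun z => ?_)
  rw [norm_mul]
  calc ‖σ z‖ * ‖f z‖ ≤ (1 + τ z) * ‖f z‖ := by gcongr; exact hστ z
    _ = _ := by simp [add_mul]

theorem ae_convolutionExistsAt_norm_of_norm_le_one_add (hσ : AEStronglyMeasurable σ)
    (hτ : Integrable τ) (hστ : ∀ z, ‖σ z‖ ≤ 1 + τ z) {f : V → ℝ} (hf : Integrable f) :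
    ∀ᵐ x, ConvolutionExistsAt (fun z => ‖σ z‖) f x (ContinuousLinearMap.mul ℝ ℝ) volume := by
  filter_upwards [hτ.ae_convolution_exists (ContinuousLinearMap.mul ℝ ℝ) hf.norm] with x hx
  refine Integrable.mono' ((hf.norm.comp_sub_left x).add hx)
    (hσ.norm.convolution_integrand_snd _ hf.aestronglyMeasurable x) (.of_forall fun t => ?_)
  simp only [ContinuousLinearMap.mul_apply', norm_mul, norm_norm, Pi.add_apply]
  calc ‖σ t‖ * ‖f (x - t)‖ ≤ (1 + τ t) * ‖f (x - t)‖ := by gcongr; exact hστ t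
    _ = _ := by ring

theorem integrable_prod_convolution_mul (hσ : AEStronglyMeasurable σ) (hτ : Integrable τ)
    (hστ : ∀ z, ‖σ z‖ ≤ 1 + τ z) {Φ θ : V → ℂ} (hΦ : Integrable Φ) (hθ : Integrable θ) {C : ℝ}
    (hC : ∀ z, ‖θ z‖ ≤ C) :
    Integrable (fun q : V × V => σ q.2 * Φ (q.1 - q.2) * θ q.1) (volume.prod volume) := by
  have h1 : Integrable (fun q : V × V => ‖θ q.1‖ * ‖Φ (q.1 - q.2)‖) (volume.prod volume) := by
    have := (hθ.norm.convolution_integrand (ContinuousLinearMap.mul ℝ ℝ)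
      hΦ.comp_neg.norm).swap
    simpa [Function.comp_def] using this
  have h2 : Integrable (fun q : V × V => ‖τ q.2‖ * ‖Φ (q.1 - q.2)‖) (volume.prod volume) :=
    hτ.norm.convolution_integrand (ContinuousLinearMap.mul ℝ ℝ) hΦ.norm
  refine (h1.add (h2.mul_const C)).mono'
    ((hσ.convolution_integrand (ContinuousLinearMap.mul ℂ ℂ) hΦ.aestronglyMeasurable).mul
      hθ.aestronglyMeasurable.comp_fst) (.of_forall fun q => ?_)
  simp only [norm_mul, Pi.add_apply]
  calc ‖σ q.2‖ * ‖Φ (q.1 - q.2)‖ * ‖θ q.1‖ ≤ (1 + ‖τ q.2‖) * ‖Φ (q.1 - q.2)‖ * ‖θ q.1‖ := by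
        gcongr
        exact (hστ _).trans (by gcongr; exact Real.le_norm_self _)
    _ = ‖θ q.1‖ * ‖Φ (q.1 - q.2)‖ + ‖τ q.2‖ * ‖Φ (q.1 - q.2)‖ * ‖θ q.1‖ := by ring
    _ ≤ _ := by gcongr; exact hC _

/-- If the spectrum of `σ` is contained in a set `Q` that is mapped into its interior by
contractions, then `σ` annihilates the Fourier transforms of all Schwartz functions that vanish
on `Q`. -/
theorem integral_mul_fourier_eq_zero_of_forall_mem_eq_zero (hσ : AEStronglyMeasurable σ)
    (hτ : Integrable τ) (hστ : ∀ z, ‖σ z‖ ≤ 1 + τ z) {Q : Set V}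
    (hQ : ∀ z ∈ Q, ∀ δ ∈ Set.Ioo (0 : ℝ) 1, δ • z ∈ interior Q)
    (hσhat : ∀ ψ : 𝓢(V, ℂ), Disjoint (tsupport ψ) Q → ∫ z, σ z * 𝓕 (ψ : V → ℂ) z = 0)
    (u : 𝓢(V, ℂ)) (hu : ∀ z ∈ Q, u z = 0) : ∫ z, σ z * 𝓕 (u : V → ℂ) z = 0 := by
  obtain ⟨C, hC0, hC⟩ := (𝓕 u).exists_norm_le_one_add_norm_rpow (Module.finrank ℝ V + 1)
  set N : ℕ := Module.finrank ℝ V + 1 with hN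
  rw [SchwartzMap.fourier_coe] at hC
  have hcont : Continuous (𝓕 (u : V → ℂ)) := continuous_fourier_of_integrable u.integrable
  have hev : ∀ᶠ δ : ℝ in 𝓝[<] 1, δ ∈ Set.Ioo (0 : ℝ) 1 :=
    Ioo_mem_nhdsLT one_pos
  have hlim : Tendsto (fun δ : ℝ => ∫ z, σ z * 𝓕 (u : V → ℂ) (δ⁻¹ • z)) (𝓝[<] 1)
      (𝓝 (∫ z, σ z * 𝓕 (u : V → ℂ) z)) := by
    refine tendsto_integral_filter_of_dominated_convergence
      (fun z => ‖σ z * ((C * (1 + ‖z‖) ^ (-(N : ℝ)) : ℝ) : ℂ)‖) ?_ ?_ ?_ ?_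
    · exact .of_forall fun δ => hσ.mul (by fun_prop)
    · filter_upwards [hev] with δ hδ
      refine .of_forall fun z => ?_
      rw [norm_mul, norm_mul, Complex.norm_real]
      gcongr
      refine (hC _).trans ((?_ : _ ≤ C * (1 + ‖z‖) ^ (-(N : ℝ))).trans (le_abs_self _))
      refine mul_le_mul_of_nonneg_left ?_ hC0
      refine Real.rpow_le_rpow_of_nonpos (by positivity) ?_ (by simp)
      rw [norm_smul, norm_inv, Real.norm_of_nonneg hδ.1.le]
      gcongr
      exact le_mul_of_one_le_left (norm_nonneg _) ((one_le_inv₀ hδ.1).2 hδ.2.le)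
    · refine (integrable_mul_of_norm_le_one_add hσ hτ hστ
        (integrable_one_add_norm_rpow_finrank.const_mul C).ofReal (C := C) fun z => ?_).norm
      rw [RCLike.norm_ofReal, abs_of_nonneg (by positivity)]
      exact mul_le_of_le_one_right hC0
        (Real.rpow_le_one_of_one_le_of_nonpos (by simp) (neg_nonpos.2 (Nat.cast_nonneg _)))
    · refine .of_forall fun z => ?_
      have h : Tendsto (fun δ : ℝ => δ⁻¹ • z) (𝓝[<] 1) (𝓝 z) := by
        have : ContinuousAt (fun δ : ℝ => δ⁻¹ • z) 1 := by fun_prop (disch := norm_num)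
        simpa [ContinuousAt] using this.tendsto.mono_left nhdsWithin_le_nhds
      exact ((hcont.tendsto z).comp h).const_mul _
  refine tendsto_nhds_unique hlim (tendsto_const_nhds.congr' ?_)
  filter_upwards [hev] with δ hδ
  let e : V ≃L[ℝ] V := ContinuousLinearEquiv.smulLeft (Units.mk0 δ hδ.1.ne')
  let ψ : 𝓢(V, ℂ) := ((δ : ℂ) ^ Module.finrank ℝ V) •
    SchwartzMap.compCLMOfContinuousLinearEquiv ℂ e u
  have hψ : (ψ : V → ℂ) = fun z => (δ : ℂ) ^ Module.finrank ℝ V * u (δ • z) := rfl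
  have hdisj : Disjoint (tsupport ψ) Q := by
    refine Set.disjoint_right.2 fun z hz => notMem_tsupport_iff_eventuallyEq.2 ?_
    have : ContinuousAt (fun w : V => δ • w) z := by fun_prop
    filter_upwards [this (isOpen_interior.mem_nhds (hQ z hz δ hδ))] with w hw
    simp [hψ, hu _ (interior_subset hw)]
  rw [← hσhat ψ hdisj, hψ]
  simp_rw [fourier_dilation _ hδ.1]

theorem fourier_mul_fourierInv_eq_integral {φ θ : V → ℂ} (hφ : Integrable φ) (hθ : Integrable θ)
    (t : V) : 𝓕 (fun z => φ z * 𝓕⁻ θ z) t = ∫ x, 𝓕⁻ φ (x - t) * θ x := by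
  have h := integral_fourierInv_mul_eq_mul_fourierInv
    ((Real.fourierIntegral_convergent_iff t).2 hφ) hθ
  rw [Real.fourier_eq]
  simp_rw [← smul_mul_assoc, ← h]
  congr 1
  ext x
  simp only [Real.fourierInv_eq, smul_smul, ← AddChar.map_add_eq_mul, ← sub_eq_add_neg, inner_sub_right]

/-- A function with spectrum in `Q` is reproduced by convolution with the inverse Fourier
transform of a cutoff function that equals one on `Q`. -/
theorem convolution_fourierInv_ae_eq_self (hσ : AEStronglyMeasurable σ)
    (hτ : Integrable τ) (hστ : ∀ z, ‖σ z‖ ≤ 1 + τ z) {Q : Set V}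
    (hQ : ∀ z ∈ Q, ∀ δ ∈ Set.Ioo (0 : ℝ) 1, δ • z ∈ interior Q)
    (hσhat : ∀ ψ : 𝓢(V, ℂ), Disjoint (tsupport ψ) Q → ∫ z, σ z * 𝓕 (ψ : V → ℂ) z = 0)
    {φ : V → ℂ} (hφ : ContDiff ℝ ∞ φ) (hφc : HasCompactSupport φ) (hφ1 : ∀ z ∈ Q, φ z = 1) :
    convolution σ (𝓕⁻ φ) (ContinuousLinearMap.mul ℂ ℂ) volume =ᵐ[volume] σ := by
  have hφint : Integrable φ := hφ.continuous.integrable_of_hasCompactSupport hφc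
  have hΦ : Integrable (𝓕⁻ φ) := by
    have := (𝓕⁻ (hφc.toSchwartzMap hφ)).integrable (μ := volume)
    rwa [SchwartzMap.fourierInv_coe] at this
  refine ae_eq_of_integral_contDiff_smul_eq ?_ ?_ fun θ hθ hθc => ?_
  · refine (locallyIntegrable_iff).2 fun k hk => ?_
    have h := (integrable_prod_convolution_mul hσ hτ hστ hΦ
      (θ := k.indicator fun _ => 1) (C := 1)
      ((integrable_indicator_iff hk.measurableSet).2 (integrableOn_const hk.measure_lt_top.ne))
      fun z => ?_).integral_prod_left
    · rw [← integrable_indicator_iff hk.measurableSet]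
      refine h.congr (.of_forall fun x => ?_)
      by_cases hx : x ∈ k <;> simp [hx, convolution_def]
    · by_cases hz : z ∈ k <;> simp [hz]
  · refine (locallyIntegrable_iff).2 fun k hk => ?_
    refine Integrable.mono' ((integrableOn_const (C := (1 : ℝ)) hk.measure_lt_top.ne).add
      hτ.integrableOn) hσ.restrict (.of_forall hστ)
  · have hθ' : ContDiff ℝ ∞ fun z => (θ z : ℂ) := Complex.ofRealCLM.contDiff.comp hθ
    have hθc' : HasCompactSupport fun z => (θ z : ℂ) := hθc.comp_left Complex.ofReal_zero
    let Θ : 𝓢(V, ℂ) := hθc'.toSchwartzMap hθ'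
    have hΘ : ∀ z, Θ z = (θ z : ℂ) := fun _ => rfl
    let P : 𝓢(V, ℂ) := SchwartzMap.smulLeftCLM ℂ φ (𝓕⁻ Θ)
    have hP : (P : V → ℂ) = fun z => φ z * 𝓕⁻ (Θ : V → ℂ) z := by
      ext z
      rw [SchwartzMap.smulLeftCLM_apply_apply (hφc.hasTemperateGrowth hφ),
        SchwartzMap.fourierInv_coe, smul_eq_mul]
    obtain ⟨C, hC0, hC⟩ := Θ.exists_norm_le_one_add_norm_rpow 0
    have hprod := integrable_prod_convolution_mul hσ hτ hστ hΦ (θ := Θ) (C := C) Θ.integrable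
      fun z => by simpa using hC z
    have hzero := integral_mul_fourier_eq_zero_of_forall_mem_eq_zero hσ hτ hστ hQ hσhat
      (P - 𝓕⁻ Θ) fun z hz => by
        rw [sub_apply, hP, SchwartzMap.fourierInv_coe]
        simp [hφ1 z hz]
    have hF (z : V) : 𝓕 ((P - 𝓕⁻ Θ : 𝓢(V, ℂ)) : V → ℂ) z = 𝓕 (P : V → ℂ) z - Θ z := by
      rw [← SchwartzMap.fourier_coe, sub_eq_add_neg, FourierTransform.fourier_add, FourierTransform.fourier_neg, ← sub_eq_add_neg,
        FourierTransform.fourier_fourierInv_eq, sub_apply, SchwartzMap.fourier_coe]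
    have hint (S : 𝓢(V, ℂ)) : Integrable fun z => σ z * S z := by
      obtain ⟨C, hC0, hC⟩ := S.exists_norm_le_one_add_norm_rpow 0
      exact integrable_mul_of_norm_le_one_add hσ hτ hστ S.integrable (C := C)
        fun z => by simpa using hC z
    have hPint := hint (𝓕 P)
    rw [SchwartzMap.fourier_coe] at hPint
    simp_rw [hF, mul_sub] at hzero
    rw [integral_sub hPint (hint Θ), sub_eq_zero] at hzero
    calc ∫ x, θ x • convolution σ (𝓕⁻ φ) (ContinuousLinearMap.mul ℂ ℂ) volume x
        = ∫ x, ∫ t, σ t * 𝓕⁻ φ (x - t) * Θ x := by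
          congr 1
          ext x
          rw [integral_mul_const, Complex.real_smul, mul_comm, hΘ]
          rfl
      _ = ∫ t, ∫ x, σ t * 𝓕⁻ φ (x - t) * Θ x := integral_integral_swap hprod
      _ = ∫ t, σ t * 𝓕 (P : V → ℂ) t := by
          congr 1
          ext t
          rw [hP, fourier_mul_fourierInv_eq_integral hφint Θ.integrable]
          simp_rw [mul_assoc]
          rw [integral_const_mul]
      _ = ∫ t, θ t • σ t := by
          rw [hzero]
          congr 1
          ext t
          rw [Complex.real_smul, mul_comm, hΘ]

theorem convolution_convolution_ae_eq (hσ : AEStronglyMeasurable σ) (hτ : Integrable τ)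
    (hστ : ∀ z, ‖σ z‖ ≤ 1 + τ z) {h k : V → ℂ} (hh : Integrable h) (hk : Integrable k) :
    convolution (convolution σ h (ContinuousLinearMap.mul ℂ ℂ) volume) k
      (ContinuousLinearMap.mul ℂ ℂ) volume =ᵐ[volume]
    convolution σ (convolution h k (ContinuousLinearMap.mul ℂ ℂ) volume)
      (ContinuousLinearMap.mul ℂ ℂ) volume := by
  filter_upwards [ae_convolutionExistsAt_norm_of_norm_le_one_add hσ hτ hστ
    (hh.norm.integrable_convolution (ContinuousLinearMap.mul ℝ ℝ) hk.norm)] with x hx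
  refine convolution_assoc _ _ _ _ (fun a b c => mul_assoc a b c) hσ hh.aestronglyMeasurable
    hk.aestronglyMeasurable ?_ (hh.norm.ae_convolution_exists _ hk.norm) hx
  filter_upwards [ae_convolutionExistsAt_norm_of_norm_le_one_add hσ hτ hστ hh.norm] with y hy
  exact hy.of_norm _ hσ hh.aestronglyMeasurable

end Spectrum

/-- Deconvolution in the Fourier algebra: the inverse Fourier transform of `φ / 𝓕 h` is integrable,
and its convolution with `h` is the inverse Fourier transform of `φ`. -/
theorem integrable_and_convolution_ae_eq_fourierInv {h : V → ℂ} (hh : Integrable h) {φ : V → ℂ}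
    (hφ : ContDiff ℝ ∞ φ) (hφc : HasCompactSupport φ) (hne : ∀ z ∈ tsupport φ, 𝓕 h z ≠ 0) :
    Integrable (𝓕⁻ fun z => φ z / 𝓕 h z) ∧
      convolution h (𝓕⁻ fun z => φ z / 𝓕 h z) (ContinuousLinearMap.mul ℂ ℂ) volume
        =ᵐ[volume] 𝓕⁻ φ := by
  obtain ⟨k, hk, hkz⟩ := exists_fourier_eq_div hh hφ hφc hne
  have hkF : 𝓕 k = fun z => φ z / 𝓕 h z := funext hkz
  have hFk : Integrable (𝓕 k) := by
    refine (continuous_fourier_of_integrable hk).integrable_of_hasCompactSupport ?_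
    rw [hkF]
    exact hφc.mono fun z hz hφz => hz (by simp [hφz])
  rw [← hkF]
  have hae := fourierInv_fourier_ae_eq hk hFk
  refine ⟨hk.congr hae.symm, ?_⟩
  rw [convolution_congr _ (EventuallyEq.refl _ h) hae]
  have hconv : 𝓕 (convolution h k (ContinuousLinearMap.mul ℂ ℂ) volume) = φ := by
    ext z
    rw [Real.fourier_mul_convolution_eq hh hk, hkz]
    by_cases hz : z ∈ tsupport φ
    · rw [mul_div_cancel₀ _ (hne z hz)]
    · simp [image_eq_zero_of_notMem_tsupport hz]
  have hinv := fourierInv_fourier_ae_eq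
    (hh.integrable_convolution (ContinuousLinearMap.mul ℂ ℂ) hk)
    (by rw [hconv]; exact hφ.continuous.integrable_of_hasCompactSupport hφc)
  rw [hconv] at hinv
  exact hinv.symm

end FourierAlgebra

section Rihaczek

variable {d : ℕ}

/-- The splitting of a point of ℝ^{d+d} into its two halves. -/
def splitEquiv (d : ℕ) : EuclideanSpace ℝ (Fin (d + d)) ≃ᵐ
    EuclideanSpace ℝ (Fin d) × EuclideanSpace ℝ (Fin d) :=
  EuclideanSpace.finAddEquivProd.toHomeomorph.toMeasurableEquiv

theorem splitEquiv_apply (z : EuclideanSpace ℝ (Fin (d + d))) :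
    splitEquiv d z = (zx z, zxi z) := rfl

theorem measurePreserving_splitEquiv : MeasurePreserving (splitEquiv d) :=
  (WithLp.volume_preserving_ofLp (EuclideanSpace ℝ (Fin d)) (EuclideanSpace ℝ (Fin d))).comp
    (LinearIsometryEquiv.measurePreserving
      ((LinearIsometryEquiv.piLpCongrLeft 2 ℝ ℝ finSumFinEquiv.symm).trans
        (PiLp.sumPiLpEquivProdLpPiLp 2 fun _ : Fin d ⊕ Fin d => ℝ)))

theorem inner_eq_inner_zx_add_inner_zxi (z w : EuclideanSpace ℝ (Fin (d + d))) :
    inner ℝ z w = inner ℝ (zx z) (zx w) + inner ℝ (zxi z) (zxi w) := by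
  simp [PiLp.inner_apply, Fin.sum_univ_add, zx, zxi]

theorem conj_rihaczek (g : EuclideanSpace ℝ (Fin d) → ℂ)
    (w : EuclideanSpace ℝ (Fin (d + d))) :
    (starRingEnd ℂ) (rihaczek g g w) =
      𝐞 (inner ℝ (zx w) (zxi w)) • ((starRingEnd ℂ) (g (zx w)) * 𝓕 g (zxi w)) := by
  simp only [rihaczek, map_mul, Complex.conj_conj, ← Complex.exp_conj, Circle.smul_def,
    Real.fourierChar_apply, smul_eq_mul]
  rw [mul_comm]
  congr 2
  simp only [map_neg, map_mul, Complex.conj_I, Complex.conj_ofReal, map_ofNat]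
  push_cast
  ring

theorem integrable_fourierChar_smul {X : Type*} [TopologicalSpace X] [MeasurableSpace X]
    [OpensMeasurableSpace X] {μ : Measure X} {h : X → ℂ} (hh : Integrable h μ) {c : X → ℝ}
    (hc : Continuous c) : Integrable (fun x => 𝐞 (c x) • h x) μ := by
  refine hh.norm.mono' ?_ (.of_forall fun q => by rw [Circle.norm_smul])
  have hcont : Continuous fun x => (𝐞 (c x) : ℂ) := by fun_prop
  exact hcont.measurable.aestronglyMeasurable.smul hh.aestronglyMeasurable

theorem integrable_fourierChar_smul_conj_mul_fourier {g : EuclideanSpace ℝ (Fin d) → ℂ}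
    (hg : Integrable g) (hghat : Integrable (𝓕 g)) :
    Integrable fun q : EuclideanSpace ℝ (Fin d) × EuclideanSpace ℝ (Fin d) =>
      𝐞 (inner ℝ q.1 q.2) • ((starRingEnd ℂ) (g q.1) * 𝓕 g q.2) := by
  have hg' : Integrable fun x => (starRingEnd ℂ) (g x) :=
    Complex.conjCLE.toContinuousLinearMap.integrable_comp hg
  exact integrable_fourierChar_smul (hg'.mul_prod hghat) (by fun_prop)

theorem integrable_conj_rihaczek_neg {g : EuclideanSpace ℝ (Fin d) → ℂ}
    (hg : Integrable g) (hghat : Integrable (𝓕 g)) :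
    Integrable fun w => (starRingEnd ℂ) (rihaczek g g (-w)) := by
  have h := (measurePreserving_splitEquiv.integrable_comp_of_integrable
    (integrable_fourierChar_smul_conj_mul_fourier hg hghat)).comp_neg
  refine h.congr (.of_forall fun w => ?_)
  simp only [conj_rihaczek, Function.comp_apply, splitEquiv_apply]

theorem conj_UVgg (g : EuclideanSpace ℝ (Fin d) → ℂ) (z : EuclideanSpace ℝ (Fin (d + d))) :
    (starRingEnd ℂ) (UVgg g z) =
      ∫ x, 𝐞 (inner ℝ x (zx z)) • ((starRingEnd ℂ) (g x) * g (x + zxi z)) := by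
  rw [UVgg, stft, ← integral_conj]
  congr 1
  ext x
  simp only [map_mul, Complex.conj_conj, ← Complex.exp_conj, Circle.smul_def,
    Real.fourierChar_apply, smul_eq_mul, sub_neg_eq_add]
  rw [mul_comm]
  congr 2
  simp only [map_neg, map_mul, Complex.conj_I, Complex.conj_ofReal, map_ofNat,
    real_inner_comm x]
  push_cast
  ring

theorem fourier_conj_rihaczek_neg {g : EuclideanSpace ℝ (Fin d) → ℂ}
    (hg : Integrable g) (hghat : Integrable (𝓕 g)) (z : EuclideanSpace ℝ (Fin (d + d))) :
    𝓕 (fun w => (starRingEnd ℂ) (rihaczek g g (-w))) z = (starRingEnd ℂ) (UVgg g z) := by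
  let G : EuclideanSpace ℝ (Fin d) × EuclideanSpace ℝ (Fin d) → ℂ := fun q =>
    𝐞 (inner ℝ q.1 (zx z) + inner ℝ q.2 (zxi z)) •
      𝐞 (inner ℝ q.1 q.2) • ((starRingEnd ℂ) (g q.1) * 𝓕 g q.2)
  have hG : Integrable G := integrable_fourierChar_smul
    (integrable_fourierChar_smul_conj_mul_fourier hg hghat) (by fun_prop)
  have hinv := (eventually_map.1 ((measurePreserving_add_right volume
    (zxi z)).quasiMeasurePreserving.tendsto_ae (fourierInv_fourier_ae_eq hg hghat)))
  calc 𝓕 (fun w => (starRingEnd ℂ) (rihaczek g g (-w))) z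
      = ∫ w, G (splitEquiv d w) := by
        rw [Real.fourier_eq, ← integral_neg_eq_self]
        congr 1
        ext w
        rw [neg_neg, inner_neg_left, neg_neg, conj_rihaczek, inner_eq_inner_zx_add_inner_zxi]
        rfl
    _ = ∫ q, G q := measurePreserving_splitEquiv.integral_comp' G
    _ = ∫ x, ∫ ξ, G (x, ξ) := integral_prod G hG
    _ = ∫ x, 𝐞 (inner ℝ x (zx z)) • ((starRingEnd ℂ) (g x) * 𝓕⁻ (𝓕 g) (x + zxi z)) := by
        congr 1
        ext x
        rw [Real.fourierInv_eq, ← integral_const_mul, Circle.smul_def, ← integral_smul]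
        congr 1
        ext ξ
        simp only [G, inner_add_right, AddChar.map_add_eq_mul, real_inner_comm x ξ,
          Circle.smul_def, smul_eq_mul, Circle.coe_mul]
        ring
    _ = ∫ x, 𝐞 (inner ℝ x (zx z)) • ((starRingEnd ℂ) (g x) * g (x + zxi z)) := by
        refine integral_congr_ae ?_
        filter_upwards [hinv] with x hx
        rw [hx]
    _ = (starRingEnd ℂ) (UVgg g z) := (conj_UVgg g z).symm

theorem smul_mem_interior_Qbox {a b : ℝ} (ha : 0 < a) (hb : 0 < b)
    {z : EuclideanSpace ℝ (Fin (d + d))} (hz : z ∈ Qbox a b 0) {δ : ℝ}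
    (hδ : δ ∈ Set.Ioo (0 : ℝ) 1) : δ • z ∈ interior (Qbox a b 0) := by
  have hlt {c s : ℝ} (hc : 0 < c) (hs : |s| ≤ 1 / (2 * c) - 0) : |δ * s| < 1 / (2 * c) := by
    rw [abs_mul, abs_of_pos hδ.1]
    rw [sub_zero] at hs
    calc δ * |s| ≤ δ * (1 / (2 * c)) := by gcongr; exact hδ.1.le
      _ < 1 / (2 * c) := mul_lt_of_lt_one_left (by positivity) hδ.2
  let U : Set (EuclideanSpace ℝ (Fin (d + d))) :=
    {w | (∀ i, |zx w i| < 1 / (2 * a)) ∧ (∀ i, |zxi w i| < 1 / (2 * b))}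
  have hopen {f : Fin d → EuclideanSpace ℝ (Fin (d + d)) → ℝ} (hf : ∀ i, Continuous (f i))
      (c : ℝ) : IsOpen {w | ∀ i, |f i w| < c} := by
    rw [Set.ofPred_forall]
    exact isOpen_iInter_of_finite fun i => isOpen_lt (hf i).abs continuous_const
  have hU : IsOpen U :=
    (hopen (fun i => by simp only [zx]; fun_prop) _).inter
      (hopen (fun i => by simp only [zxi]; fun_prop) _)
  refine interior_maximal (fun w hw => ?_) hU (?_ : δ • z ∈ U)
  · exact ⟨fun i => by simpa using (hw.1 i).le, fun i => by simpa using (hw.2 i).le⟩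
  · exact ⟨fun i => hlt ha (hz.1 i), fun i => hlt hb (hz.2 i)⟩

end Rihaczek

/-- deconvolution identity.  For σ ∈ L^p(ℝ^{2d}), 1 ≤ p < ∞, with σ̂
supported in Q, g ∈ L¹ with ĝ ∈ L¹, a smooth compactly supported cutoff φ with φ = 1 on Q
such that conj(𝒰V_g g) does not vanish on supp φ, the kernel K = ℱ⁻¹(φ/conj(𝒰V_g g)) is
integrable and σ ∗ R(g,g)^∗ ∗ K = σ in L^p. -/
theorem statement_13 {d : ℕ} (a b : ℝ) (ha : 0 < a) (hb : 0 < b)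
    (p : ℝ≥0∞) (hp1 : 1 ≤ p) (hp2 : p ≠ ⊤)
    (σ : EuclideanSpace ℝ (Fin (d + d)) → ℂ) (hσ : MeasureTheory.MemLp σ p volume)
    (hσhat : ∀ ψ : SchwartzMap (EuclideanSpace ℝ (Fin (d + d))) ℂ,
      Disjoint (tsupport ⇑ψ) (Qbox a b 0) → ∫ z, σ z * 𝓕 (⇑ψ) z = 0)
    (g : EuclideanSpace ℝ (Fin d) → ℂ)
    (hg : MeasureTheory.Integrable g) (hghat : MeasureTheory.Integrable (𝓕 g))
    (φ : EuclideanSpace ℝ (Fin (d + d)) → ℂ)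
    (hφsm : ContDiff ℝ (⊤ : ℕ∞) φ) (hφc : HasCompactSupport φ)
    (hφ1 : ∀ z ∈ Qbox a b (0 : ℝ), φ z = 1)
    (hnv : ∀ z ∈ tsupport φ, (starRingEnd ℂ) (UVgg g z) ≠ 0) :
    MeasureTheory.Integrable (𝓕⁻ fun z => φ z / (starRingEnd ℂ) (UVgg g z)) ∧
    convolution
      (convolution σ (fun w => (starRingEnd ℂ) (rihaczek g g (-w)))
        (ContinuousLinearMap.mul ℂ ℂ) volume)
      (𝓕⁻ fun z => φ z / (starRingEnd ℂ) (UVgg g z))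
      (ContinuousLinearMap.mul ℂ ℂ) volume =ᵐ[volume] σ := by
  set R : EuclideanSpace ℝ (Fin (d + d)) → ℂ :=
    fun w => (starRingEnd ℂ) (rihaczek g g (-w))
  have hRint : Integrable R := integrable_conj_rihaczek_neg hg hghat
  have hUV : ∀ z, (starRingEnd ℂ) (UVgg g z) = 𝓕 R z :=
    fun z => (fourier_conj_rihaczek_neg hg hghat z).symm
  simp_rw [hUV] at hnv ⊢
  obtain ⟨hK, hRK⟩ := integrable_and_convolution_ae_eq_fourierInv hRint hφsm hφc hnv
  refine ⟨hK, ?_⟩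
  have hp : 1 ≤ p.toReal := by
    simpa using ENNReal.toReal_mono hp2 hp1
  have hτ : Integrable fun z => ‖σ z‖ ^ p.toReal :=
    hσ.integrable_norm_rpow (one_pos.trans_le hp1).ne' hp2
  have hστ (z : EuclideanSpace ℝ (Fin (d + d))) : ‖σ z‖ ≤ 1 + ‖σ z‖ ^ p.toReal := by
    rcases le_total ‖σ z‖ 1 with h | h
    · exact h.trans (le_add_of_nonneg_right (by positivity))
    · exact (Real.self_le_rpow_of_one_le h hp).trans (le_add_of_nonneg_left zero_le_one)
  refine (convolution_convolution_ae_eq hσ.1 hτ hστ hRint hK).trans ?_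
  rw [convolution_congr (ContinuousLinearMap.mul ℂ ℂ) (EventuallyEq.refl _ σ) hRK]
  exact convolution_fourierInv_ae_eq_self hσ.1 hτ hστ
    (fun z hz δ hδ => smul_mem_interior_Qbox ha hb hz hδ) hσhat hφsm hφc hφ1
end
end

section
/- Let a, b > 0 and let ρ ∈ L¹(ℝ²) have compact support. For λ = (λ₁, λ₂) ∈ aℤ × bℤ define F_λ(ξ, x) = exp(−πi ξ λ₂ − πi x λ₁ + π ξ λ₁ + π x λ₂). If ∫_{ℝ²} ρ(z) F_λ(z) e^{−2πi μ·z} dz = 0 for all λ ∈ aℤ × bℤ and all μ ∈ bℤ × aℤ, then ρ = 0 almost everywhere. -/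
noncomputable section

open MeasureTheory Complex Filter Real
open scoped FourierTransform Convolution Topology ENNReal

/-- the weight F_λ(ξ, x) = exp(−πi ξ λ₂ − πi x λ₁ + π ξ λ₁ + π x λ₂) on ℝ²,
where a point z ∈ ℝ² is read as z = (ξ, x) -/
def Fwt (l1 l2 : ℝ) (z : EuclideanSpace ℝ (Fin (1 + 1))) : ℂ :=
  Complex.exp (-(Real.pi : ℂ) * Complex.I * ((zx z 0 : ℝ) : ℂ) * (l2 : ℂ)
    - (Real.pi : ℂ) * Complex.I * ((zxi z 0 : ℝ) : ℂ) * (l1 : ℂ)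
    + (Real.pi : ℂ) * ((zx z 0 : ℝ) : ℂ) * (l1 : ℂ)
    + (Real.pi : ℂ) * ((zxi z 0 : ℝ) : ℂ) * (l2 : ℂ))

/-- If a compactly supported integrable function annihilates a point-separating monoid of
continuous functions that is closed under conjugation, then it vanishes almost everywhere. -/
theorem ae_eq_zero_of_forall_integral_mul_eq_zero_of_separatesPoints
    {E : Type*} [NormedAddCommGroup E] [NormedSpace ℝ E] [FiniteDimensional ℝ E]
    [MeasurableSpace E] [BorelSpace E] {ν : Measure E} [IsFiniteMeasureOnCompacts ν]
    {ρ : E → ℂ} (hρ : Integrable ρ ν) (hρc : HasCompactSupport ρ)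
    (M : Submonoid C(E, ℂ)) (hstar : ∀ f ∈ M, star f ∈ M)
    (hsep : ∀ x y : E, x ≠ y → ∃ f ∈ M, f x ≠ f y)
    (h0 : ∀ f ∈ M, ∫ z, ρ z * f z ∂ν = 0) :
    ρ =ᵐ[ν] 0 := by
  set K : Set E := tsupport ρ
  have hKc : IsCompact K := hρc
  have : CompactSpace K := isCompact_iff_compactSpace.mp hKc
  have hKm : MeasurableSet K := hKc.isClosed.measurableSet
  have hint (f : C(E, ℂ)) : ∫ z : K, ρ z * f z ∂(ν.comap (↑)) = ∫ z, ρ z * f z ∂ν := by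
    rw [integral_subtype_comap hKm (fun z => ρ z * f z)]
    refine setIntegral_eq_integral_of_forall_compl_eq_zero fun z hz => ?_
    rw [image_eq_zero_of_notMem_tsupport hz, zero_mul]
  have hρK : Integrable (fun z : K => ρ z) (ν.comap (↑)) := by
    have := hρ.integrableOn (s := K)
    rwa [integrableOn_iff_comap_subtypeVal hKm] at this
  have hmul (f : C(K, ℂ)) : Integrable (fun z : K => ρ z * f z) (ν.comap (↑)) :=
    hρK.mul_bdd (c := ‖f‖) f.continuous.aestronglyMeasurable
      (Eventually.of_forall f.norm_coe_le_norm)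
  let φ : C(K, ℂ) →L[ℂ] ℂ := LinearMap.mkContinuous
    { toFun := fun f => ∫ z : K, ρ z * f z ∂(ν.comap (↑))
      map_add' := fun f g => by
        simp only [ContinuousMap.add_apply, mul_add]
        exact integral_add (hmul f) (hmul g)
      map_smul' := fun c f => by
        simp only [ContinuousMap.smul_apply, smul_eq_mul, mul_left_comm, RingHom.id_apply]
        exact integral_const_mul _ _ }
    (∫ z : K, ‖ρ z‖ ∂(ν.comap (↑))) fun f => by
      rw [← integral_mul_const]
      refine norm_integral_le_of_norm_le (hρK.norm.mul_const _) (Eventually.of_forall fun z => ?_)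
      rw [norm_mul]
      gcongr
      exact f.norm_coe_le_norm z
  let r : C(E, ℂ) →⋆ₐ[ℂ] C(K, ℂ) := ContinuousMap.compStarAlgHom' ℂ ℂ ⟨Subtype.val, by fun_prop⟩
  have hφr (f : C(E, ℂ)) : φ (r f) = ∫ z, ρ z * f z ∂ν := hint f
  let N : Submonoid C(K, ℂ) := M.map r
  let A : StarSubalgebra ℂ C(K, ℂ) := StarAlgebra.adjoin ℂ (N : Set C(K, ℂ))
  have hA : ∀ f ∈ A, φ f = 0 := by
    intro f hf
    have hN : (N : Set C(K, ℂ)) ∪ star (N : Set C(K, ℂ)) = N := by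
      refine Set.union_eq_left.mpr ?_
      rintro f ⟨g, hg, hgf⟩
      refine ⟨star g, hstar g hg, ?_⟩
      rw [map_star]
      exact star_eq_iff_star_eq.mpr hgf.symm
    have hf' : f ∈ Submodule.span ℂ (N : Set C(K, ℂ)) := by
      have : f ∈ A.toSubalgebra := hf
      rw [StarAlgebra.adjoin_toSubalgebra, hN, ← Subalgebra.mem_toSubmodule,
        Algebra.adjoin_eq_span, Submonoid.closure_eq] at this
      exact this
    have hle : Submodule.span ℂ (N : Set C(K, ℂ)) ≤ LinearMap.ker φ.toLinearMap := by
      refine Submodule.span_le.mpr ?_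
      rintro _ ⟨g, hg, rfl⟩
      exact (hφr g).trans (h0 g hg)
    exact hle hf'
  have hsepA : A.SeparatesPoints := by
    intro x y hxy
    obtain ⟨f, hf, hne⟩ := hsep x y fun h => hxy (Subtype.ext h)
    exact ⟨r f, ⟨r f, StarAlgebra.subset_adjoin ℂ _ ⟨f, hf, rfl⟩, rfl⟩, hne⟩
  have hdense := ContinuousMap.starSubalgebra_topologicalClosure_eq_top_of_separatesPoints A hsepA
  have hφ (f : C(K, ℂ)) : φ f = 0 := by
    have hf : f ∈ closure (A : Set C(K, ℂ)) := by
      rw [← StarSubalgebra.topologicalClosure_coe, hdense]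
      trivial
    exact closure_minimal (t := {f | φ f = 0}) hA (isClosed_eq φ.continuous continuous_const) hf
  refine ae_eq_zero_of_integral_contDiff_smul_eq_zero hρ.locallyIntegrable fun g hg _ => ?_
  have hgc : Continuous g := hg.continuous
  rw [← hφ (r ⟨fun z => (g z : ℂ), by fun_prop⟩), hφr]
  refine integral_congr_ae (Eventually.of_forall fun z => ?_)
  simp [mul_comm]

/-- The exponential `F_λ(z) e^{-2πi μ·z}` with `λ = (a k, b l)` and `μ = (b m, a n)`. -/
def weightedCharacter (a b : ℝ) (k l m n : ℤ) : C(EuclideanSpace ℝ (Fin (1 + 1)), ℂ) where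
  toFun z := Complex.exp (π * ((a * k * z 0 + b * l * z 1 : ℝ) : ℂ) -
    π * Complex.I * ((b * (l + 2 * m) * z 0 + a * (k + 2 * n) * z 1 : ℝ) : ℂ))

theorem weightedCharacter_apply (a b : ℝ) (k l m n : ℤ)
    (z : EuclideanSpace ℝ (Fin (1 + 1))) :
    weightedCharacter a b k l m n z = Fwt (a * k) (b * l) z *
      Complex.exp (-(2 * Real.pi * Complex.I) *
        ((inner ℝ (mk2 (vecd b fun _ => m) (vecd a fun _ => n)) z : ℝ) : ℂ)) := by
  have hinner : inner ℝ (mk2 (vecd b fun _ => m) (vecd a fun _ => n)) z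
      = b * m * z 0 + a * n * z 1 := by
    have h1 : (finSumFinEquiv.symm (0 : Fin (1 + 1)) : Fin 1 ⊕ Fin 1) = Sum.inl 0 := rfl
    have h2 : (finSumFinEquiv.symm (1 : Fin (1 + 1)) : Fin 1 ⊕ Fin 1) = Sum.inr 0 := rfl
    rw [PiLp.inner_apply, Fin.sum_univ_two]
    simp [mk2, vecd, h1, h2, mul_comm]
  have hx : zx z 0 = z 0 := rfl
  have hxi : zxi z 0 = z 1 := rfl
  rw [Fwt, hinner, hx, hxi, ← Complex.exp_add, weightedCharacter, ContinuousMap.coe_mk]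
  congr 1
  push_cast
  ring

theorem weightedCharacter_zero (a b : ℝ) : weightedCharacter a b 0 0 0 0 = 1 := by
  ext z
  simp [weightedCharacter]

theorem weightedCharacter_mul (a b : ℝ) (k l m n k' l' m' n' : ℤ) :
    weightedCharacter a b k l m n * weightedCharacter a b k' l' m' n' =
      weightedCharacter a b (k + k') (l + l') (m + m') (n + n') := by
  ext z
  simp only [weightedCharacter, ContinuousMap.mul_apply, ContinuousMap.coe_mk,
    ← Complex.exp_add]
  congr 1
  push_cast
  ring

theorem star_weightedCharacter (a b : ℝ) (k l m n : ℤ) :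
    star (weightedCharacter a b k l m n) = weightedCharacter a b k l (-l - m) (-k - n) := by
  ext z
  simp only [weightedCharacter, ContinuousMap.star_apply, ContinuousMap.coe_mk,
    RCLike.star_def, ← Complex.exp_conj, map_sub, map_mul, Complex.conj_ofReal, Complex.conj_I]
  congr 1
  push_cast
  ring

theorem norm_weightedCharacter (a b : ℝ) (k l m n : ℤ) (z : EuclideanSpace ℝ (Fin (1 + 1))) :
    ‖weightedCharacter a b k l m n z‖ = Real.exp (π * (a * k * z 0 + b * l * z 1)) := by
  rw [weightedCharacter, ContinuousMap.coe_mk, Complex.norm_exp]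
  congr 1
  simp only [Complex.sub_re, Complex.mul_re, Complex.mul_im, Complex.ofReal_re,
    Complex.ofReal_im, Complex.I_re, Complex.I_im]
  ring

/-- The functions `F_λ(z) e^{-2πi μ·z}` form a multiplicative monoid. -/
def weightedCharacterSubmonoid (a b : ℝ) : Submonoid C(EuclideanSpace ℝ (Fin (1 + 1)), ℂ) where
  carrier := {f | ∃ k l m n : ℤ, weightedCharacter a b k l m n = f}
  one_mem' := ⟨0, 0, 0, 0, weightedCharacter_zero a b⟩
  mul_mem' := by
    rintro _ _ ⟨k, l, m, n, rfl⟩ ⟨k', l', m', n', rfl⟩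
    exact ⟨_, _, _, _, (weightedCharacter_mul a b k l m n k' l' m' n').symm⟩

theorem weightedCharacterSubmonoid_separates {a b : ℝ} (ha : 0 < a) (hb : 0 < b)
    {x y : EuclideanSpace ℝ (Fin (1 + 1))} (hxy : x ≠ y) :
    ∃ f ∈ weightedCharacterSubmonoid a b, f x ≠ f y := by
  contrapose! hxy
  have h (k l : ℤ) : a * k * x 0 + b * l * x 1 = a * k * y 0 + b * l * y 1 := by
    have := congrArg norm (hxy _ ⟨k, l, 0, 0, rfl⟩)
    rw [norm_weightedCharacter, norm_weightedCharacter, Real.exp_eq_exp] at this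
    exact mul_left_cancel₀ Real.pi_ne_zero this
  ext i
  fin_cases i
  · simpa [ha.ne'] using h 1 0
  · simpa [hb.ne'] using h 0 1

/-- if ρ ∈ L¹(ℝ²) has compact support and all Fourier coefficients of
ρ·F_λ at the points of bℤ × aℤ vanish, for all λ ∈ aℤ × bℤ, then ρ = 0 a.e. -/
theorem statement_14 (a b : ℝ) (ha : 0 < a) (hb : 0 < b)
    (ρ : EuclideanSpace ℝ (Fin (1 + 1)) → ℂ)
    (hρ : MeasureTheory.Integrable ρ) (hρc : HasCompactSupport ρ)
    (h0 : ∀ k l m n : ℤ,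
      ∫ z, ρ z * Fwt (a * k) (b * l) z *
        Complex.exp (-(2 * Real.pi * Complex.I) *
          ((inner ℝ (mk2 (vecd b fun _ => m) (vecd a fun _ => n)) z : ℝ) : ℂ)) = 0) :
    ρ =ᵐ[volume] 0 := by
  refine ae_eq_zero_of_forall_integral_mul_eq_zero_of_separatesPoints hρ hρc
    (weightedCharacterSubmonoid a b) ?_
    (fun x y hxy => weightedCharacterSubmonoid_separates ha hb hxy) ?_
  · rintro _ ⟨k, l, m, n, rfl⟩
    exact ⟨_, _, _, _, (star_weightedCharacter a b k l m n).symm⟩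
  · rintro _ ⟨k, l, m, n, rfl⟩
    simpa only [weightedCharacter_apply, mul_assoc] using h0 k l m n
end
end
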